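/- arXiv:1711.08408 — 2 statements merged into one kernel-verified Lean document; each statement's English description precedes it below -/
import Mathlib

section
/- Let H_1, …, H_K ∈ ℂ^{N_r × N_t}, let V ∈ ℂ^{N_t × N_RF}, let c > 0, let N_s ≤ N_RF, let Ĩ ∈ ℂ^{N_RF × N_RF} be the diagonal matrix with its first N_s diagonal entries equal to 1 and the rest 0, and for each k let U_k ∈ ℂ^{N_RF × N_RF} be unitary. Define F₁ = (1/K) Σ_{k=1}^K H_kᴴ H_k. Then (1/K) · Σ_{k=1}^K log det(I + c · U_kᴴ Vᴴ H_kᴴ H_k V U_k Ĩ) ≤ log det(I + c · Vᴴ F₁ V). -/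
open Matrix Finset ComplexOrder

theorem aux_factor {n : ℕ} {M : Matrix (Fin n) (Fin n) ℂ} (hM : M.PosSemidef) :
    ∃ B : Matrix (Fin n) (Fin n) ℂ, M = Bᴴ * B := by
  open scoped MatrixOrder in
  exact CStarAlgebra.nonneg_iff_eq_star_mul_self.mp hM.nonneg

theorem aux_log_le {n : ℕ} {X : Matrix (Fin n) (Fin n) ℂ} (hX : X.PosDef) :
    Real.log X.det.re ≤ X.trace.re - n := by
  have h1 : X.det.re = ∏ i, hX.1.eigenvalues i := by
    rw [hX.1.det_eq_prod_eigenvalues]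
    have : (∏ i, ((hX.1.eigenvalues i : ℝ) : ℂ)) = ((∏ i, hX.1.eigenvalues i : ℝ) : ℂ) := by
      push_cast; rfl
    exact (congrArg Complex.re this).trans (Complex.ofReal_re _)
  have h2 : X.trace.re = ∑ i, hX.1.eigenvalues i := by
    rw [hX.1.trace_eq_sum_eigenvalues]
    have : (∑ i, ((hX.1.eigenvalues i : ℝ) : ℂ)) = ((∑ i, hX.1.eigenvalues i : ℝ) : ℂ) := by
      push_cast; rfl
    exact (congrArg Complex.re this).trans (Complex.ofReal_re _)
  rw [h1, h2, Real.log_prod (fun i _ => (hX.eigenvalues_pos i).ne')]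
  have h3 : ∑ i, Real.log (hX.1.eigenvalues i) ≤ ∑ i, (hX.1.eigenvalues i - 1) :=
    Finset.sum_le_sum fun i _ => Real.log_le_sub_one_of_pos (hX.eigenvalues_pos i)
  simpa [Finset.sum_sub_distrib] using h3

theorem aux_trace_nonneg {n : ℕ} {M P : Matrix (Fin n) (Fin n) ℂ} (hM : M.PosSemidef)
    (hP : P.PosSemidef) : 0 ≤ (M * P).trace.re := by
  obtain ⟨B, rfl⟩ := aux_factor hM
  have h : (Bᴴ * B * P).trace = (B * P * Bᴴ).trace := by
    rw [Matrix.mul_assoc, Matrix.trace_mul_comm]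
  rw [h]
  exact (Complex.le_def.1 (hP.mul_mul_conjTranspose_same B).trace_nonneg).1

theorem aux_tangent {n : ℕ} {M X : Matrix (Fin n) (Fin n) ℂ} (hM : M.PosDef) (hX : X.PosDef) :
    Real.log X.det.re ≤ Real.log M.det.re + ((M⁻¹ * X).trace.re - n) := by
  obtain ⟨B, hB⟩ := aux_factor hM.inv.posSemidef
  have hMd : M.det ≠ 0 := hM.det_pos.ne'
  have hd : Bᴴ.det * B.det * M.det = 1 := by
    rw [← Matrix.det_mul, ← hB, ← Matrix.det_mul, Matrix.nonsing_inv_mul _ hMd.isUnit,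
      Matrix.det_one]
  have hXY : (B * X * Bᴴ).det * M.det = X.det := by
    rw [Matrix.det_mul, Matrix.det_mul]
    linear_combination X.det * hd
  have hY : (B * X * Bᴴ).PosDef := by
    rw [(hX.posSemidef.mul_mul_conjTranspose_same B).posDef_iff_det_ne_zero]
    intro h0
    rw [h0, zero_mul] at hXY
    exact hX.det_pos.ne hXY
  have hl := aux_log_le hY
  have ht : (B * X * Bᴴ).trace = (M⁻¹ * X).trace := by
    rw [hB, Matrix.mul_assoc Bᴴ, ← Matrix.trace_mul_comm]
  rw [ht] at hl
  have p1 := Complex.lt_def.1 hY.det_pos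
  have p2 := Complex.lt_def.1 hM.det_pos
  have hre : X.det.re = (B * X * Bᴴ).det.re * M.det.re := by
    rw [← hXY, Complex.mul_re, ← p2.2]; simp
  have q1 : 0 < (B * X * Bᴴ).det.re := p1.1
  have q2 : 0 < M.det.re := p2.1
  rw [hre, Real.log_mul q1.ne' q2.ne']
  linarith

theorem aux_mono {n : ℕ} {M X : Matrix (Fin n) (Fin n) ℂ} (hM : M.PosDef) (hX : X.PosDef)
    (h : (M - X).PosSemidef) : Real.log X.det.re ≤ Real.log M.det.re := by
  have h1 := aux_tangent hM hX
  have h2 := aux_trace_nonneg hM.inv.posSemidef h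
  have hMd : M.det ≠ 0 := hM.det_pos.ne'
  rw [Matrix.mul_sub, Matrix.nonsing_inv_mul _ hMd.isUnit, Matrix.trace_sub, Matrix.trace_one] at h2
  simp at h2
  linarith

theorem aux_concave {n K : ℕ} (hK : 0 < K) {M : Matrix (Fin n) (Fin n) ℂ}
    {X : Fin K → Matrix (Fin n) (Fin n) ℂ} (hM : M.PosDef) (hX : ∀ k, (X k).PosDef)
    (h : ∑ k, X k = (K : ℂ) • M) :
    (1 / (K : ℝ)) * ∑ k, Real.log (X k).det.re ≤ Real.log M.det.re := by
  have hMd : M.det ≠ 0 := hM.det_pos.ne'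
  have h1 : ∑ k, Real.log (X k).det.re ≤
      ∑ k, (Real.log M.det.re + ((M⁻¹ * X k).trace.re - n)) :=
    Finset.sum_le_sum fun k _ => aux_tangent hM (hX k)
  have h2 : ∑ k, (M⁻¹ * X k).trace.re = K * n := by
    rw [← Complex.re_sum, ← Matrix.trace_sum, ← Finset.mul_sum, h, Matrix.mul_smul,
      Matrix.nonsing_inv_mul _ hMd.isUnit, Matrix.trace_smul, Matrix.trace_one]
    simp
  rw [Finset.sum_add_distrib, Finset.sum_sub_distrib, h2] at h1
  simp at h1
  have hK' : (0 : ℝ) < K := by exact_mod_cast hK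
  rw [one_div, inv_mul_le_iff₀ hK']
  exact h1

theorem aux_posDef {n : ℕ} {P : Matrix (Fin n) (Fin n) ℂ} {c : ℝ} (hc : 0 < c)
    (hP : P.PosSemidef) : (1 + (c : ℂ) • P).PosDef :=
  Matrix.PosDef.one.add_posSemidef (hP.smul (by exact_mod_cast hc.le))

/-- Upper bound (13)–(14) of the paper: for channels `H_k`, an analog precoder `V`,
unitary `U_k`, `c > 0`, and the stream-selection matrix `Ĩ = diag(1,…,1,0,…,0)` with
`N_s ≤ N_RF` ones, the average rate satisfies
`(1/K) ∑_k log det(I + c U_kᴴ Vᴴ H_kᴴ H_k V U_k Ĩ) ≤ log det(I + c Vᴴ F₁ V)` where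
`F₁ = (1/K) ∑_k H_kᴴ H_k`. -/
theorem avg_rate_le_logdet_avg_covariance {Nr Nt NRF Ns K : ℕ} (hK : 0 < K)
    (hNs : Ns ≤ NRF)
    (H : Fin K → Matrix (Fin Nr) (Fin Nt) ℂ)
    (V : Matrix (Fin Nt) (Fin NRF) ℂ)
    (c : ℝ) (hc : 0 < c)
    (U : Fin K → Matrix (Fin NRF) (Fin NRF) ℂ)
    (hU : ∀ k, U k ∈ Matrix.unitaryGroup (Fin NRF) ℂ)
    (Itil : Matrix (Fin NRF) (Fin NRF) ℂ)
    (hItil : Itil = Matrix.diagonal (fun j : Fin NRF => if (j : ℕ) < Ns then (1 : ℂ) else 0))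
    (F₁ : Matrix (Fin Nt) (Fin Nt) ℂ)
    (hF₁ : F₁ = (K : ℂ)⁻¹ • ∑ k, (H k)ᴴ * H k) :
    (1 / (K : ℝ)) * ∑ k, Real.log
        ((1 + (c : ℂ) • ((U k)ᴴ * Vᴴ * (H k)ᴴ * H k * V * U k * Itil)).det.re)
      ≤ Real.log ((1 + (c : ℂ) • (Vᴴ * F₁ * V)).det.re) := by
  have hKc : (K : ℂ) ≠ 0 := by exact_mod_cast hK.ne'
  have hA : ∀ k, (Vᴴ * ((H k)ᴴ * H k) * V).PosSemidef := fun k =>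
    (Matrix.posSemidef_conjTranspose_mul_self (H k)).conjTranspose_mul_mul_same V
  have hsum : ∑ k, Vᴴ * ((H k)ᴴ * H k) * V = (K : ℂ) • (Vᴴ * F₁ * V) := by
    rw [hF₁, Matrix.mul_smul, Matrix.smul_mul, smul_smul, mul_inv_cancel₀ hKc, one_smul,
      Matrix.mul_sum, Matrix.sum_mul]
  have hF : (Vᴴ * F₁ * V).PosSemidef := by
    refine Matrix.PosSemidef.conjTranspose_mul_mul_same ?_ V
    rw [hF₁]
    refine (Matrix.posSemidef_sum _ fun k _ =>
      Matrix.posSemidef_conjTranspose_mul_self (H k)).smul ?_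
    rw [← Complex.ofReal_natCast, ← Complex.ofReal_inv]
    exact_mod_cast (by positivity : (0 : ℝ) ≤ (K : ℝ)⁻¹)
  have hterm : ∀ k, Real.log
        ((1 + (c : ℂ) • ((U k)ᴴ * Vᴴ * (H k)ᴴ * H k * V * U k * Itil)).det.re)
      ≤ Real.log ((1 + (c : ℂ) • (Vᴴ * ((H k)ᴴ * H k) * V)).det.re) := by
    intro k
    obtain ⟨G, hG⟩ : ∃ G, G = H k * V * U k := ⟨_, rfl⟩
    have hUU : U k * (U k)ᴴ = 1 := (Matrix.mem_unitaryGroup_iff).1 (hU k)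
    have hGG : G * Gᴴ = (H k * V) * (H k * V)ᴴ := by
      rw [hG, Matrix.conjTranspose_mul (H k * V), Matrix.mul_assoc, ← Matrix.mul_assoc (U k), hUU,
        Matrix.one_mul]
    have e1 : (1 + (c : ℂ) • ((U k)ᴴ * Vᴴ * (H k)ᴴ * H k * V * U k * Itil)).det
        = (1 + (c : ℂ) • (G * Itil * Gᴴ)).det := by
      have : (c : ℂ) • ((U k)ᴴ * Vᴴ * (H k)ᴴ * H k * V * U k * Itil)
          = Gᴴ * ((c : ℂ) • (G * Itil)) := by
        simp only [hG, Matrix.conjTranspose_mul, Matrix.mul_smul, Matrix.mul_assoc]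
      rw [this, Matrix.det_one_add_mul_comm, Matrix.smul_mul]
    have e2 : (1 + (c : ℂ) • (Vᴴ * ((H k)ᴴ * H k) * V)).det
        = (1 + (c : ℂ) • (G * Gᴴ)).det := by
      have : (c : ℂ) • (Vᴴ * ((H k)ᴴ * H k) * V)
          = (H k * V)ᴴ * ((c : ℂ) • (H k * V)) := by
        simp only [Matrix.conjTranspose_mul, Matrix.mul_smul, Matrix.mul_assoc]
      rw [this, Matrix.det_one_add_mul_comm, Matrix.smul_mul, hGG]
    rw [e1, e2]
    have hI : Itil.PosSemidef := by
      rw [hItil]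
      refine Matrix.PosSemidef.diagonal fun j => ?_
      simp only [Pi.zero_apply]
      split_ifs <;> simp
    have hI' : (1 - Itil).PosSemidef := by
      rw [hItil, ← Matrix.diagonal_one, Matrix.diagonal_sub]
      refine Matrix.PosSemidef.diagonal fun j => ?_
      simp only [Pi.zero_apply]
      split_ifs <;> simp
    refine aux_mono (aux_posDef hc (Matrix.posSemidef_self_mul_conjTranspose G))
      (aux_posDef hc (hI.mul_mul_conjTranspose_same G)) ?_
    have : (1 + (c : ℂ) • (G * Gᴴ)) - (1 + (c : ℂ) • (G * Itil * Gᴴ))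
        = (c : ℂ) • (G * (1 - Itil) * Gᴴ) := by
      rw [Matrix.mul_sub, Matrix.sub_mul, Matrix.mul_one, smul_sub]
      abel
    rw [this]
    exact (hI'.mul_mul_conjTranspose_same G).smul (by exact_mod_cast hc.le)
  refine le_trans (mul_le_mul_of_nonneg_left (Finset.sum_le_sum fun k _ => hterm k)
    (by positivity)) ?_
  refine aux_concave hK (aux_posDef hc hF) (fun k => aux_posDef hc (hA k)) ?_
  rw [Finset.sum_add_distrib, ← Finset.smul_sum, hsum, smul_add, smul_comm (c : ℂ)]
  simp [Nat.cast_smul_eq_nsmul]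
end

section
/- Let F ∈ ℂ^{N × N} be Hermitian positive semidefinite, let c > 0, and let V ∈ ℂ^{N × m} be written as V = [V̄ | v], where v ∈ ℂ^N is one column of V and V̄ ∈ ℂ^{N × (m−1)} collects the remaining columns. Define C = I_{m−1} + c · V̄ᴴ F V̄ (which is Hermitian positive definite, hence invertible) and G = c F − c² F V̄ C^{-1} V̄ᴴ F. Then det(I_m + c · Vᴴ F V) = det(C) · (1 + vᴴ G v). -/
open Matrix ComplexOrder

/-- Schur-complement factorization used in the coordinate descent algorithm:
for Hermitian positive semidefinite `F`, `c > 0`, and `V = [V̄ | v]`,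
with `C = I + c V̄ᴴ F V̄` (Hermitian positive definite, hence invertible) and
`G = c F − c² F V̄ C⁻¹ V̄ᴴ F`, one has
`det(I + c Vᴴ F V) = det C · (1 + vᴴ G v)`. -/
theorem det_schur_column_factorization {N m : ℕ}
    (F : Matrix (Fin N) (Fin N) ℂ) (hF : F.PosSemidef)
    (c : ℝ) (hc : 0 < c)
    (Vbar : Matrix (Fin N) (Fin m) ℂ) (v : Fin N → ℂ)
    (V : Matrix (Fin N) (Fin (m + 1)) ℂ)
    (hV : V = Matrix.of (fun i => Fin.snoc (Vbar i) (v i)))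
    (C : Matrix (Fin m) (Fin m) ℂ)
    (hC : C = 1 + (c : ℂ) • (Vbarᴴ * F * Vbar))
    (G : Matrix (Fin N) (Fin N) ℂ)
    (hG : G = (c : ℂ) • F - ((c : ℝ)^2 : ℂ) • (F * Vbar * C⁻¹ * Vbarᴴ * F)) :
    C.PosDef ∧
    (1 + (c : ℂ) • (Vᴴ * F * V)).det = C.det * (1 + star v ⬝ᵥ G.mulVec v) := by
  have hPD : C.PosDef := by
    rw [hC]
    refine Matrix.PosDef.one.add_posSemidef ?_
    refine Matrix.PosSemidef.smul (hF.conjTranspose_mul_mul_same Vbar) ?_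
    exact_mod_cast hc.le
  refine ⟨hPD, ?_⟩
  set w : Matrix (Fin N) (Fin 1) ℂ := Matrix.of fun i _ => v i with hw
  have hVe : V.submatrix id (finSumFinEquiv : Fin m ⊕ Fin 1 ≃ Fin (m + 1)) =
      Matrix.fromCols Vbar w := by
    ext i j
    rcases j with j | j
    · simp only [hV, submatrix_apply, of_apply, finSumFinEquiv_apply_left, fromCols_apply_inl, id]
      exact Fin.snoc_castSucc (α := fun _ => ℂ) (v i) (Vbar i) j
    · have : j = 0 := Subsingleton.elim _ _
      subst this
      simp only [hV, submatrix_apply, of_apply, finSumFinEquiv_apply_right, fromCols_apply_inr, id,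
        hw]
      exact Fin.snoc_last (α := fun _ => ℂ) (v i) (Vbar i)
  have hblk : (1 + (c : ℂ) • (Vᴴ * F * V)).submatrix
      (finSumFinEquiv : Fin m ⊕ Fin 1 ≃ Fin (m + 1)) finSumFinEquiv =
      Matrix.fromBlocks C ((c : ℂ) • (Vbarᴴ * F * w)) ((c : ℂ) • (wᴴ * F * Vbar))
        (1 + (c : ℂ) • (wᴴ * F * w)) := by
    have h1 : (Vᴴ * F * V).submatrix
        (finSumFinEquiv : Fin m ⊕ Fin 1 ≃ Fin (m + 1)) finSumFinEquiv =
        (Matrix.fromCols Vbar w)ᴴ * F * Matrix.fromCols Vbar w := by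
      rw [← hVe]
      rfl
    rw [Matrix.submatrix_add, Matrix.submatrix_smul]
    simp only [Pi.add_apply, Pi.smul_apply]
    rw [h1, Matrix.submatrix_one_equiv, Matrix.conjTranspose_fromCols_eq_fromRows_conjTranspose,
      Matrix.fromRows_mul, Matrix.fromRows_mul_fromCols, Matrix.fromBlocks_smul,
      ← Matrix.fromBlocks_one, Matrix.fromBlocks_add, hC, zero_add, zero_add]
  haveI : Invertible C := hPD.isUnit.invertible
  rw [← Matrix.det_submatrix_equiv_self (finSumFinEquiv : Fin m ⊕ Fin 1 ≃ Fin (m + 1)), hblk,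
    Matrix.det_fromBlocks₁₁, Matrix.invOf_eq_nonsing_inv]
  congr 1
  have h2 : 1 + (c : ℂ) • (wᴴ * F * w) -
      (c : ℂ) • (wᴴ * F * Vbar) * C⁻¹ * ((c : ℂ) • (Vbarᴴ * F * w)) = 1 + wᴴ * (G * w) := by
    rw [hG]
    simp only [Matrix.sub_mul, Matrix.mul_sub, Matrix.smul_mul, Matrix.mul_smul, Matrix.mul_assoc,
      smul_smul, pow_two, add_sub_assoc]
  rw [h2, Matrix.det_fin_one, Matrix.add_apply, Matrix.one_apply_eq]
  rfl
end
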